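/- Let L be a Lie ring and H a subring of L. Then for all natural numbers i < j, [H^i, C_L^j(H)] ⊆ C_L^{j-i-1}(H). In particular H^{i-1} and C_L^i(H) commute. -/

import Mathlib

/-- The set-theoretic normalizer of a subset of a Lie ring. -/
def setNormalizer {L : Type*} [LieRing L] (S : Set L) : Set L :=
  {x | ∀ s ∈ S, ⁅x, s⁆ ∈ S}

/-- Iterated centralizers `C_L^n(A)`: `C^0 = 0` and
`C^{n+1} = {x ∈ ⋂_{1 ≤ i ≤ n} N_L(C^i) : [x, A] ⊆ C^n}`. -/
def iterCent {L : Type*} [LieRing L] (A : Set L) : ℕ → Set L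
  | 0 => {0}
  | n + 1 =>
      {x | (∀ i, 1 ≤ i → i ≤ n → x ∈ setNormalizer (iterCent A i)) ∧
        ∀ a ∈ A, ⁅x, a⁆ ∈ iterCent A n}

/-- `[X,Y]`: the additive subgroup generated by brackets. -/
def bracketSpan {L : Type*} [LieRing L] (X Y : Set L) : AddSubgroup L :=
  AddSubgroup.closure {z | ∃ x ∈ X, ∃ y ∈ Y, z = ⁅x, y⁆}

/-- Lower central series of a subset: `X^0 = ⟨X⟩`, `X^{n+1} = [X, X^n]`. -/
def lcsSet {L : Type*} [LieRing L] (X : Set L) : ℕ → AddSubgroup L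
  | 0 => AddSubgroup.closure X
  | n + 1 => bracketSpan X (lcsSet X n)

theorem iterCent_addSubgroup {L : Type*} [LieRing L] (A : Set L) (n : ℕ) :
    ∃ S : AddSubgroup L, (S : Set L) = iterCent A n := by
  induction n using Nat.strong_induction_on with
  | _ n ih =>
    cases n with
    | zero => exact ⟨⊥, by simp [iterCent]⟩
    | succ n =>
      have hz : ∀ i, i ≤ n → (0 : L) ∈ iterCent A i := by
        intro i hi
        obtain ⟨S, hS⟩ := ih i (by omega)
        rw [← hS]; exact S.zero_mem
      have ha : ∀ i, i ≤ n → ∀ x ∈ iterCent A i, ∀ y ∈ iterCent A i, x + y ∈ iterCent A i := by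
        intro i hi
        obtain ⟨S, hS⟩ := ih i (by omega)
        rw [← hS]; intro x hx y hy; exact S.add_mem hx hy
      have hn : ∀ i, i ≤ n → ∀ x ∈ iterCent A i, -x ∈ iterCent A i := by
        intro i hi
        obtain ⟨S, hS⟩ := ih i (by omega)
        rw [← hS]; intro x hx; exact S.neg_mem hx
      refine ⟨{ carrier := iterCent A (n + 1), zero_mem' := ?_, add_mem' := ?_, neg_mem' := ?_ }, rfl⟩
      · intro x y hx hy
        rw [iterCent] at hx hy ⊢
        refine ⟨fun i h1 h2 s hs => ?_, fun a haA => ?_⟩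
        · rw [add_lie]; exact ha i h2 _ (hx.1 i h1 h2 s hs) _ (hy.1 i h1 h2 s hs)
        · rw [add_lie]; exact ha n le_rfl _ (hx.2 a haA) _ (hy.2 a haA)
      · rw [iterCent]
        refine ⟨fun i h1 h2 s hs => ?_, fun a haA => ?_⟩
        · rw [zero_lie]; exact hz i h2
        · rw [zero_lie]; exact hz n le_rfl
      · intro x hx
        change x ∈ iterCent A (n + 1) at hx
        change -x ∈ iterCent A (n + 1)
        rw [iterCent] at hx ⊢
        refine ⟨fun i h1 h2 s hs => ?_, fun a haA => ?_⟩
        · rw [neg_lie]; exact hn i h2 _ (hx.1 i h1 h2 s hs)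
        · rw [neg_lie]; exact hn n le_rfl _ (hx.2 a haA)

theorem lie_mem_iterCent_of_left {L : Type*} [LieRing L] (A : Set L) (n : ℕ) (a y : L)
    (ha : a ∈ A) (hy : y ∈ iterCent A (n + 1)) : ⁅a, y⁆ ∈ iterCent A n := by
  rw [iterCent] at hy
  have h := hy.2 a ha
  obtain ⟨S, hS⟩ := iterCent_addSubgroup A n
  rw [← hS] at h ⊢
  rw [← lie_skew]
  exact S.neg_mem h

theorem lie_lcs_mem {L : Type*} [LieRing L] (A : Set L) (i : ℕ) :
    ∀ m : ℕ, ∀ x ∈ lcsSet A i, ∀ y ∈ iterCent A (m + i + 1), ⁅x, y⁆ ∈ iterCent A m := by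
  induction i with
  | zero =>
    intro m x hx y hy
    obtain ⟨S, hS⟩ := iterCent_addSubgroup A m
    rw [lcsSet] at hx
    induction hx using AddSubgroup.closure_induction with
    | mem a ha => exact lie_mem_iterCent_of_left A m a y ha hy
    | zero => rw [zero_lie, ← hS]; exact S.zero_mem
    | add a b _ _ ha hb => rw [add_lie]; rw [← hS] at *; exact S.add_mem ha hb
    | neg a _ ha => rw [neg_lie]; rw [← hS] at *; exact S.neg_mem ha
  | succ i ih =>
    intro m x hx y hy
    obtain ⟨S, hS⟩ := iterCent_addSubgroup A m
    rw [lcsSet, bracketSpan] at hx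
    induction hx using AddSubgroup.closure_induction with
    | mem a ha =>
      obtain ⟨h, hh, k, hk, rfl⟩ := ha
      have e1 : ⁅h, ⁅k, y⁆⁆ ∈ iterCent A m :=
        lie_mem_iterCent_of_left A m h _ hh
          (ih (m + 1) k hk y (by rwa [show m + 1 + i + 1 = m + (i + 1) + 1 by omega]))
      have e2 : ⁅k, ⁅h, y⁆⁆ ∈ iterCent A m :=
        ih m k hk _ (lie_mem_iterCent_of_left A (m + i + 1) h y hh hy)
      rw [lie_lie]
      rw [← hS] at *
      exact S.sub_mem e1 e2
    | zero => rw [zero_lie, ← hS]; exact S.zero_mem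
    | add a b _ _ ha hb => rw [add_lie]; rw [← hS] at *; exact S.add_mem ha hb
    | neg a _ ha => rw [neg_lie]; rw [← hS] at *; exact S.neg_mem ha

/-- For a subring `H` of a Lie ring `L` and `i < j`,
`[H^i, C_L^j(H)] ⊆ C_L^{j-i-1}(H)`; in particular `H^{i-1}` and `C_L^i(H)`
commute. -/
theorem bracket_lcs_iterCent {L : Type*} [LieRing L] (H : LieSubalgebra ℤ L) :
    (∀ i j : ℕ, i < j →
      ∀ z ∈ bracketSpan (lcsSet (H : Set L) i : Set L) (iterCent (H : Set L) j),
        z ∈ iterCent (H : Set L) (j - i - 1)) ∧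
    (∀ i : ℕ, 1 ≤ i → ∀ x ∈ lcsSet (H : Set L) (i - 1),
      ∀ y ∈ iterCent (H : Set L) i, ⁅x, y⁆ = 0) := by
  refine ⟨?_, ?_⟩
  · intro i j hij z hz
    obtain ⟨m, rfl⟩ : ∃ m, j = m + i + 1 := ⟨j - i - 1, by omega⟩
    rw [show m + i + 1 - i - 1 = m by omega]
    obtain ⟨S, hS⟩ := iterCent_addSubgroup (H : Set L) m
    have key : bracketSpan (lcsSet (H : Set L) i : Set L) (iterCent (H : Set L) (m + i + 1)) ≤ S := by
      rw [bracketSpan, AddSubgroup.closure_le]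
      rintro _ ⟨x, hx, y, hy, rfl⟩
      rw [hS]
      exact lie_lcs_mem _ i m x hx y hy
    rw [← hS]
    exact key hz
  · intro i hi x hx y hy
    have h := lie_lcs_mem (H : Set L) (i - 1) 0 x hx y
      (by rwa [show 0 + (i - 1) + 1 = i by omega])
    simpa [iterCent] using h
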